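/- Assume β_{m−1} ∈ A, β_m ∈ A_𝔎 with ord(det β_m) = r, and that the dPI iterates satisfy ord(det β_{m+1}) = −r and ord(det β_{m+2}) = −r. Then the matrix 𝒜 := (m+3)·I_N − β_{m+3}·β_{m+2} belongs to A_𝔎. -/

import Mathlib

open Matrix

noncomputable section

/-- The field `ℂ((ε))` of formal Laurent series over `ℂ`. -/
abbrev LS : Type := LaurentSeries ℂ

/-- Index type for `N × N` matrices in `2 × 2` block form, `N = r + s` with `s = N - r`. -/
abbrev Idx (r s : ℕ) : Type := Fin r ⊕ Fin s

/-- The complex matrix of coefficients of `ε^k` of a matrix of Laurent series. -/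
def coeffM {r s : ℕ} (M : Matrix (Idx r s) (Idx r s) LS) (k : ℤ) :
    Matrix (Idx r s) (Idx r s) ℂ :=
  Matrix.of fun i j => (M i j).coeff k

/-- `M ∈ A`: every entry of `M` is a power series (no negative coefficients). -/
def memA {r s : ℕ} (M : Matrix (Idx r s) (Idx r s) LS) : Prop :=
  ∀ i j, ∀ k : ℤ, k < 0 → (M i j).coeff k = 0

/-- `X ∈ 𝔎`: complex matrices whose first `r` rows vanish. -/
def memK {r s : ℕ} (X : Matrix (Idx r s) (Idx r s) ℂ) : Prop :=
  ∀ (i : Fin r) (j : Idx r s), X (Sum.inl i) j = 0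

/-- `X ∈ 𝔏`: complex matrices whose last `N - r` columns vanish. -/
def memL {r s : ℕ} (X : Matrix (Idx r s) (Idx r s) ℂ) : Prop :=
  ∀ (i : Idx r s) (j : Fin s), X i (Sum.inr j) = 0

/-- `M ∈ A_𝔎`: `M ∈ A` and `M|_{ε=0} ∈ 𝔎`. -/
def memAK {r s : ℕ} (M : Matrix (Idx r s) (Idx r s) LS) : Prop :=
  memA M ∧ memK (coeffM M 0)

/-- `M ∈ A_𝔏`: `M ∈ A` and `M|_{ε=0} ∈ 𝔏`. -/
def memAL {r s : ℕ} (M : Matrix (Idx r s) (Idx r s) LS) : Prop :=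
  memA M ∧ memL (coeffM M 0)

/-- The Laurent series `ε`. -/
def eps : LS := HahnSeries.single (1 : ℤ) (1 : ℂ)

/-- A constant complex matrix viewed as a matrix of Laurent series. -/
def constM {r s : ℕ} (X : Matrix (Idx r s) (Idx r s) ℂ) :
    Matrix (Idx r s) (Idx r s) LS :=
  X.map (algebraMap ℂ LS)

abbrev phi : PowerSeries ℂ →+* LS := HahnSeries.ofPowerSeries ℤ ℂ

abbrev PM (r s : ℕ) : Type := Matrix (Idx r s) (Idx r s) (PowerSeries ℂ)

/-- entrywise embedding of power series matrices -/
def FM (r s : ℕ) : PM r s →+* Matrix (Idx r s) (Idx r s) LS := phi.mapMatrix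

/-- diag(ε, 1) -/
def DM (r s : ℕ) : PM r s :=
  Matrix.diagonal (Sum.elim (fun _ => PowerSeries.X) (fun _ => 1))

lemma FM_apply {r s : ℕ} (P : PM r s) (i j) : FM r s P i j = phi (P i j) := rfl

lemma phi_coeff_neg (p : PowerSeries ℂ) (k : ℤ) (hk : k < 0) : (phi p).coeff k = 0 := by
  have := PowerSeries.coeff_coe p k
  rw [if_pos hk] at this
  exact this

lemma phi_coeff_nat (p : PowerSeries ℂ) (n : ℕ) : (phi p).coeff (n : ℤ) = PowerSeries.coeff n p :=
  LaurentSeries.coeff_coe_powerSeries p n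

lemma memA_iff {r s : ℕ} (M : Matrix (Idx r s) (Idx r s) LS) :
    memA M ↔ ∃ P, FM r s P = M := by
  constructor
  · intro h
    refine ⟨Matrix.of fun i j => PowerSeries.mk fun n => (M i j).coeff n, ?_⟩
    ext i j k
    rw [FM_apply]
    rcases lt_or_ge k 0 with hk | hk
    · rw [phi_coeff_neg _ _ hk, h i j k hk]
    · lift k to ℕ using hk
      rw [phi_coeff_nat]
      simp
  · rintro ⟨P, rfl⟩ i j k hk
    rw [FM_apply, phi_coeff_neg _ _ hk]

lemma memAK_iff {r s : ℕ} (M : Matrix (Idx r s) (Idx r s) LS) :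
    memAK M ↔ ∃ P, FM r s (DM r s * P) = M := by
  constructor
  · rintro ⟨hA, hK⟩
    obtain ⟨Q, rfl⟩ := (memA_iff M).1 hA
    have h0 : ∀ (i : Fin r) (j : Idx r s), PowerSeries.X ∣ Q (Sum.inl i) j := by
      intro i j
      rw [PowerSeries.X_dvd_iff]
      have := hK i j
      simp only [coeffM, Matrix.of_apply, FM_apply] at this
      have h2 := phi_coeff_nat (Q (Sum.inl i) j) 0
      rw [Nat.cast_zero, this] at h2
      simpa using h2.symm
    choose f hf using h0
    refine ⟨Matrix.of fun i j => Sum.elim (fun a => f a j) (fun b => Q (Sum.inr b) j) i, ?_⟩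
    congr 1
    ext1 i j
    rw [DM, Matrix.diagonal_mul]
    rcases i with i | i
    · simp [hf]
    · simp
  · rintro ⟨P, rfl⟩
    refine ⟨(memA_iff _).2 ⟨_, rfl⟩, ?_⟩
    intro i j
    simp only [coeffM, Matrix.of_apply, FM_apply]
    have h2 := phi_coeff_nat ((DM r s * P) (Sum.inl i) j) 0
    rw [Nat.cast_zero] at h2
    rw [h2, DM, Matrix.diagonal_mul]
    simp

lemma det_FM {r s : ℕ} (P : PM r s) : (FM r s P).det = phi P.det :=
  (RingHom.map_det phi P).symm

lemma det_FM_DM (r s : ℕ) : (FM r s (DM r s)).det ≠ 0 ∧ (FM r s (DM r s)).det.order = r := by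
  have h : (FM r s (DM r s)).det = HahnSeries.single (r : ℤ) (1 : ℂ) := by
    rw [det_FM, DM, Matrix.det_diagonal]
    simp
  rw [h]
  exact ⟨by simp, HahnSeries.order_single one_ne_zero⟩

lemma unit_of_order {r s : ℕ} (P : PM r s) (h0 : (FM r s P).det ≠ 0)
    (h : (FM r s P).det.order = 0) : ∃ Q, P * Q = 1 ∧ Q * P = 1 := by
  have hu : IsUnit P.det := by
    rw [PowerSeries.isUnit_iff_constantCoeff, isUnit_iff_ne_zero]
    intro hc
    have h2 := phi_coeff_nat P.det 0
    rw [← det_FM, Nat.cast_zero, ← h] at h2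
    have h3 := HahnSeries.coeff_order_eq_zero.not.2 h0
    apply h3
    rw [h2]
    simpa using hc
  exact ⟨P⁻¹, Matrix.mul_nonsing_inv _ hu, Matrix.nonsing_inv_mul _ hu⟩

lemma order_mul' (x y : LS) (hx : x ≠ 0) (hy : y ≠ 0) : (x * y).order = x.order + y.order :=
  HahnSeries.order_mul hx hy

lemma natsmul {r s : ℕ} (m : ℕ) (M : Matrix (Idx r s) (Idx r s) LS) :
    (m : LS) • M = (m : Matrix (Idx r s) (Idx r s) LS) * M := by
  ext1 i j
  rw [← Matrix.diagonal_natCast, Matrix.diagonal_mul]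
  rfl

lemma natsmul' {r s : ℕ} (m k : ℕ) (M : Matrix (Idx r s) (Idx r s) LS) :
    ((m : LS) + (k : LS)) • M = ((m + k : ℕ) : Matrix (Idx r s) (Idx r s) LS) * M := by
  rw [← Nat.cast_add, natsmul]

lemma algebra_id {R : Type*} [Ring R] (m : ℕ) (B C E a b β1 β2 β3 p : R)
    (hB : B * β1 = 1) (hC : b * C = 1) (hE : E * β2 = 1)
    (h1 : β1 = (m : R) * C - p - b - a)
    (h2 : β2 = ((m + 1 : ℕ) : R) * B - b - β1 - a)
    (h3 : β3 = ((m + 2 : ℕ) : R) * E - β1 - β2 - a) :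
    ((m + 3 : ℕ) : R) * (1 : R) - β3 * β2 =
      (((m + 1 : ℕ) : R) * B - b) * (((m + 1 : ℕ) : R) * B - b)
        - (((m + 1 : ℕ) : R) * B - b) * a - b * (p + b + a) := by
  have e1 : b * β1 = (m : R) - b * (p + b + a) := by
    rw [h1, sub_sub, sub_sub, mul_sub, ← mul_assoc, ← Nat.cast_comm, mul_assoc, hC, mul_one,
      ← add_assoc]
  generalize hg : ((m + 1 : ℕ) : R) * B - b = g at *
  have e2 : g * β1 = ((m + 1 : ℕ) : R) - b * β1 := by
    rw [← hg, sub_mul, mul_assoc, hB, mul_one]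
  have e3 : β3 = ((m + 2 : ℕ) : R) * E - g := by
    rw [h3, h2]; abel
  have e4 : β3 * β2 = ((m + 2 : ℕ) : R) - g * β2 := by
    rw [e3, sub_mul, mul_assoc, hE, mul_one]
  have e5 : g * β2 = g * g - g * β1 - g * a := by
    rw [h2, mul_sub, mul_sub]
  rw [e4, e5, e2, e1]
  push_cast
  have e6 : (3 : R) = 1 + 1 + 1 := by norm_num
  have e7 : (2 : R) = 1 + 1 := by norm_num
  rw [e6, e7]
  noncomm_ring

/-- Assume `β_{m−1} ∈ A`, `β_m ∈ A_𝔎` with `ord(det β_m) = r`, and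
that the dPI iterates satisfy `ord(det β_{m+1}) = −r` and `ord(det β_{m+2}) = −r`.
Then the matrix `𝒜 := (m+3)·I_N − β_{m+3}·β_{m+2}` belongs to `A_𝔎`. -/
theorem A_matrix_in_AK (r s m : ℕ) (hr : 0 < r) (hs : 0 < s) (hm : 2 ≤ m)
    (α : Matrix (Idx r s) (Idx r s) ℂ)
    (βprev βm β1 β2 β3 : Matrix (Idx r s) (Idx r s) LS)
    (hprev : memA βprev) (hβm : memAK βm)
    (hdm : βm.det ≠ 0 ∧ βm.det.order = (r : ℤ))
    (hd1 : β1.det ≠ 0 ∧ β1.det.order = -(r : ℤ))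
    (hd2 : β2.det ≠ 0 ∧ β2.det.order = -(r : ℤ))
    (h1 : β1 = (m : LS) • βm⁻¹ - βprev - βm - constM α)
    (h2 : β2 = ((m : LS) + 1) • β1⁻¹ - βm - β1 - constM α)
    (h3 : β3 = ((m : LS) + 2) • β2⁻¹ - β1 - β2 - constM α) :
    memAK (((m : LS) + 3) • (1 : Matrix (Idx r s) (Idx r s) LS) - β3 * β2) := by
  have s1 : ∀ M : Matrix (Idx r s) (Idx r s) LS, ((m : LS) + 1) • M =
      ((m + 1 : ℕ) : Matrix (Idx r s) (Idx r s) LS) * M := fun M => by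
    rw [← natsmul' m 1, Nat.cast_one]
  have s2 : ∀ M : Matrix (Idx r s) (Idx r s) LS, ((m : LS) + 2) • M =
      ((m + 2 : ℕ) : Matrix (Idx r s) (Idx r s) LS) * M := fun M => by
    rw [← natsmul' m 2, Nat.cast_ofNat]
  have s3 : ∀ M : Matrix (Idx r s) (Idx r s) LS, ((m : LS) + 3) • M =
      ((m + 3 : ℕ) : Matrix (Idx r s) (Idx r s) LS) * M := fun M => by
    rw [← natsmul' m 3, Nat.cast_ofNat]
  rw [natsmul] at h1
  rw [s1] at h2
  rw [s2] at h3
  rw [s3]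
  clear s1 s2 s3
  obtain ⟨U, hU⟩ := (memAK_iff _).1 hβm
  obtain ⟨pr, hpr⟩ := (memA_iff _).1 hprev
  obtain ⟨dD, oD⟩ := det_FM_DM r s
  have hal : ∃ a, FM r s a = constM α := by
    refine ⟨α.map (algebraMap ℂ (PowerSeries ℂ)), ?_⟩
    ext1 i j
    rw [FM_apply, constM, Matrix.map_apply, Matrix.map_apply]
    rfl
  obtain ⟨a, ha⟩ := hal
  have hU' : FM r s (DM r s) * FM r s U = βm := by rw [← map_mul, hU]
  have hdU : (FM r s (DM r s)).det * (FM r s U).det = βm.det := by rw [← Matrix.det_mul, hU']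
  have dU : (FM r s U).det ≠ 0 := by
    intro h
    rw [h, mul_zero] at hdU
    exact hdm.1 hdU.symm
  have oU : (FM r s U).det.order = 0 := by
    have := order_mul' _ _ dD dU
    rw [hdU, hdm.2, oD] at this
    linarith
  obtain ⟨Ui, hUi, hUi'⟩ := unit_of_order U dU oU
  have hD : IsUnit (FM r s (DM r s)).det := isUnit_iff_ne_zero.2 dD
  have hC : βm⁻¹ * FM r s (DM r s) = FM r s Ui := by
    have : βm⁻¹ = FM r s Ui * (FM r s (DM r s))⁻¹ := by
      apply Matrix.inv_eq_left_inv
      rw [← hU', mul_assoc, ← mul_assoc _ (FM r s (DM r s)), Matrix.nonsing_inv_mul _ hD, one_mul,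
        ← map_mul, hUi', map_one]
    rw [this, mul_assoc, Matrix.nonsing_inv_mul _ hD, mul_one]
  have hV : ∃ V, FM r s V = β1 * FM r s (DM r s) := by
    refine ⟨(m : PM r s) * Ui - (pr + DM r s * U + a) * DM r s, ?_⟩
    rw [h1, sub_sub, sub_sub, sub_mul, mul_assoc, hC, map_sub, map_mul, map_mul, map_add,
      map_add, hpr, hU, ha, map_natCast, add_assoc]
  obtain ⟨V, hV⟩ := hV
  have hdV : (FM r s V).det = β1.det * (FM r s (DM r s)).det := by rw [hV, Matrix.det_mul]
  obtain ⟨Vi, hVi, hVi'⟩ := unit_of_order V (by rw [hdV]; exact mul_ne_zero hd1.1 dD)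
    (by rw [hdV, order_mul' _ _ hd1.1 dD, hd1.2, oD]; ring)
  have hB : β1⁻¹ = FM r s (DM r s * Vi) := by
    apply Matrix.inv_eq_right_inv
    rw [map_mul, ← mul_assoc, ← hV, ← map_mul, hVi, map_one]
  rw [algebra_id m β1⁻¹ βm⁻¹ β2⁻¹ (constM α) βm β1 β2 β3 βprev
    (Matrix.nonsing_inv_mul _ (isUnit_iff_ne_zero.2 hd1.1))
    (Matrix.mul_nonsing_inv _ (isUnit_iff_ne_zero.2 hdm.1))
    (Matrix.nonsing_inv_mul _ (isUnit_iff_ne_zero.2 hd2.1)) h1 h2 h3]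
  have hg : ((m + 1 : ℕ) : Matrix (Idx r s) (Idx r s) LS) * β1⁻¹ - βm
      = FM r s (DM r s * (((m + 1 : ℕ) : PM r s) * Vi - U)) := by
    rw [hB, ← hU, mul_sub, map_sub, ← mul_assoc, ← Nat.cast_comm, mul_assoc, map_mul _ (Nat.cast _),
      map_natCast]
  generalize ((m + 1 : ℕ) : PM r s) * Vi - U = G at hg
  rw [hg, ← ha, ← hU, ← hpr, memAK_iff]
  refine ⟨G * (DM r s * G) - G * a
    - U * (pr + DM r s * U + a), ?_⟩
  simp only [← map_mul, ← map_add, ← map_sub]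
  congr 1
  simp only [mul_sub, sub_mul, mul_assoc]
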